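/- arXiv:1412.5976 — 3 statements merged into one kernel-verified Lean document; each statement's English description precedes it below -/
import Mathlib

section
/- (Atomic Uniqueness) Let L be a countable first-order language and T a complete L-theory. If A and B are countable atomic models of T, then A and B are isomorphic as L-structures. -/
open FirstOrder FirstOrder.Language

/-- `φ` is a complete formula for the theory `T`: for every formula `ψ` in the same free
variables, exactly one of `T ⊨ ∀x⃗(φ → ψ)` and `T ⊨ ∀x⃗(φ → ¬ψ)` holds. -/
def IsCompleteFormula {L : FirstOrder.Language.{u, v}} (T : L.Theory) {α : Type*}
    (φ : L.Formula α) : Prop :=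
  ∀ ψ : L.Formula α, Xor' (T ⊨ᵇ φ.imp ψ) (T ⊨ᵇ φ.imp ψ.not)

/-- A model `A` of `T` is atomic if every finite tuple of elements of `A` satisfies some
complete formula for `T` in `A`. -/
def IsAtomicModel {L : FirstOrder.Language.{u, v}} (T : L.Theory) (A : Type*)
    [L.Structure A] : Prop :=
  ∀ (n : ℕ) (a : Fin n → A),
    ∃ φ : L.Formula (Fin n), IsCompleteFormula T φ ∧ φ.Realize a

section

variable {L : FirstOrder.Language.{u, v}} {A : Type w} {B : Type x} [L.Structure A] [L.Structure B]

variable (L) in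
/-- A correspondence `s ⊆ A × B` is elementary if corresponding finite tuples satisfy the same
formulas. -/
def IsElementaryCorrespondence (s : Set (A × B)) : Prop :=
  ∀ (n : ℕ) (p : Fin n → A × B), (∀ i, p i ∈ s) → ∀ φ : L.Formula (Fin n),
    φ.Realize (Prod.fst ∘ p) ↔ φ.Realize (Prod.snd ∘ p)

theorem IsElementaryCorrespondence.swap {s : Set (A × B)}
    (hs : IsElementaryCorrespondence L s) :
    IsElementaryCorrespondence L (Prod.swap ⁻¹' s) := fun n p hp φ =>
  (hs n (Prod.swap ∘ p) hp φ).symm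

theorem isElementaryCorrespondence_range {n : ℕ} {p : Fin n → A × B}
    (h : ∀ φ : L.Formula (Fin n), φ.Realize (Prod.fst ∘ p) ↔ φ.Realize (Prod.snd ∘ p)) :
    IsElementaryCorrespondence L (Set.range p) := by
  intro m q hq φ
  choose σ hσ using hq
  obtain rfl : p ∘ σ = q := funext hσ
  simpa only [Formula.realize_relabel, Function.comp_assoc] using h (φ.relabel σ)

theorem isElementaryCorrespondence_empty {T : L.Theory} (hT : T.IsComplete)
    [Nonempty A] [Nonempty B] (hA : A ⊨ T) (hB : B ⊨ T) :
    IsElementaryCorrespondence L (∅ : Set (A × B)) := by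
  intro n p hp φ
  let e : Fin n → Empty := fun i => (hp i).elim
  have h : A ⊨ (φ.relabel e : L.Sentence) ↔ B ⊨ (φ.relabel e : L.Sentence) :=
    (hT.realize_sentence_iff _ A).trans (hT.realize_sentence_iff _ B).symm
  rw [Sentence.Realize, Sentence.Realize, Formula.realize_relabel, Formula.realize_relabel] at h
  convert h using 2 <;> exact funext fun i => (hp i).elim

theorem IsCompleteFormula.realize_iff {T : L.Theory} {α : Type*} {φ : L.Formula α}
    (hφ : IsCompleteFormula T φ) [Nonempty A] [Nonempty B] (hA : A ⊨ T) (hB : B ⊨ T)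
    {a : α → A} {b : α → B} (ha : φ.Realize a) (hb : φ.Realize b) (ψ : L.Formula α) :
    ψ.Realize a ↔ ψ.Realize b := by
  rcases hφ ψ with ⟨h, -⟩ | ⟨h, -⟩
  · exact iff_of_true (Formula.realize_imp.1 (h.realize_formula A) ha)
      (Formula.realize_imp.1 (h.realize_formula B) hb)
  · exact iff_of_false (Formula.realize_not.1 (Formula.realize_imp.1 (h.realize_formula A) ha))
      (Formula.realize_not.1 (Formula.realize_imp.1 (h.realize_formula B) hb))

theorem realize_exists_head {n : ℕ} {φ : L.Formula (Fin (n + 1))} {v : Fin n → A} :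
    ((φ.relabel (Fin.cons (.inr ()) Sum.inl : Fin (n + 1) → Fin n ⊕ Unit)).iExs Unit).Realize v ↔
      ∃ a : A, φ.Realize (Fin.cons a v) := by
  have h (c : Unit → A) :
      Sum.elim v c ∘ (Fin.cons (.inr ()) Sum.inl : Fin (n + 1) → Fin n ⊕ Unit) =
        Fin.cons (c ()) v :=
    funext (Fin.cases rfl fun _ => rfl)
  simp only [Formula.realize_iExs, Formula.realize_relabel, h]
  exact ⟨fun ⟨c, hc⟩ => ⟨c (), hc⟩, fun ⟨a, ha⟩ => ⟨fun _ => a, ha⟩⟩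

theorem IsElementaryCorrespondence.exists_insert {T : L.Theory} [Nonempty A] [Nonempty B]
    (hA : A ⊨ T) (hB : B ⊨ T) (hAatomic : IsAtomicModel T A) {s : Set (A × B)}
    (hs : IsElementaryCorrespondence L s) (hfin : s.Finite) (a : A) :
    ∃ b : B, IsElementaryCorrespondence L (insert (a, b) s) := by
  obtain ⟨n, p, -, rfl⟩ := hfin.fin_param
  obtain ⟨φ, hφ, ha⟩ := hAatomic (n + 1) (Fin.cons a (Prod.fst ∘ p))
  obtain ⟨b, hb⟩ := realize_exists_head.1
    ((hs n p (fun i => ⟨i, rfl⟩) _).1 (realize_exists_head.2 ⟨a, ha⟩))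
  refine ⟨b, ?_⟩
  rw [← Fin.range_cons]
  refine isElementaryCorrespondence_range fun ψ => ?_
  convert hφ.realize_iff hA hB ha hb ψ using 2 <;> exact funext (Fin.cases rfl fun _ => rfl)

theorem IsElementaryCorrespondence.fst_eq_iff {s : Set (A × B)}
    (hs : IsElementaryCorrespondence L s) {p q : A × B} (hp : p ∈ s) (hq : q ∈ s) :
    p.1 = q.1 ↔ p.2 = q.2 := by
  have h := hs 2 ![p, q] (by simp [Fin.forall_fin_two, hp, hq])
    (((Term.var 0 : L.Term (Fin 2))).equal (.var 1))
  simpa [Formula.realize_equal] using h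

theorem IsElementaryCorrespondence.nonempty_equiv {s : Set (A × B)}
    (hs : IsElementaryCorrespondence L s) (hfst : ∀ a, ∃ b, (a, b) ∈ s)
    (hsnd : ∀ b, ∃ a, (a, b) ∈ s) : Nonempty (A ≃[L] B) := by
  choose f hf using hfst
  choose g hg using hsnd
  refine ⟨{ toFun := f, invFun := g, left_inv := fun a => ?_, right_inv := fun b => ?_,
            map_fun' := fun {n} F x => ?_, map_rel' := fun {n} R x => ?_ }⟩
  · exact (hs.fst_eq_iff (hg (f a)) (hf a)).2 rfl
  · exact (hs.fst_eq_iff (hf (g b)) (hg b)).1 rfl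
  · let y : Fin (n + 1) → A := Fin.cons (Structure.funMap F x) x
    have h := hs (n + 1) (fun i => (y i, f (y i))) (fun i => hf _)
      ((Term.var 0).equal (.func F fun i => .var i.succ))
    simpa [y, Formula.realize_equal, Function.comp_def] using h
  · have h := hs n (fun i => (x i, f (x i))) (fun i => hf _) (R.formula fun i => .var i)
    simpa [Formula.realize_rel, Function.comp_def] using h.symm

/-- The finite elementary correspondences, ordered by inclusion. -/
abbrev FiniteElementaryCorrespondence (L : FirstOrder.Language.{u, v}) (A : Type w) (B : Type x)
    [L.Structure A] [L.Structure B] :=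
  {s : Set (A × B) // s.Finite ∧ IsElementaryCorrespondence L s}

theorem isElementaryCorrespondence_iUnion_ideal
    (I : Order.Ideal (FiniteElementaryCorrespondence L A B)) :
    IsElementaryCorrespondence L (⋃ s ∈ I, s.1) := by
  intro n p hp φ
  simp only [Set.mem_iUnion, exists_prop] at hp
  choose t htI hpt using hp
  obtain ⟨u, huI, hu⟩ : ∃ u ∈ I, ∀ i, t i ≤ u := by
    have : Nonempty I := I.nonempty.to_subtype
    have hdir : IsDirectedOrder I := ⟨fun x y => by
      obtain ⟨z, hz, hxz, hyz⟩ := I.directed _ x.2 _ y.2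
      exact ⟨⟨z, hz⟩, hxz, hyz⟩⟩
    obtain ⟨u, hu⟩ := Finite.exists_le fun i => (⟨t i, htI i⟩ : I)
    exact ⟨u, u.2, hu⟩
  exact u.2.2 n p (fun i => hu i (hpt i)) φ

end

/-- (Atomic Uniqueness) If `A` and `B` are countable atomic models of a complete theory `T`
in a countable language, then `A ≅ B`. -/
theorem atomic_uniqueness {L : FirstOrder.Language.{u, v}} [Countable L.Symbols]
    {T : L.Theory} (hT : T.IsComplete)
    (A : Type w) (B : Type x) [L.Structure A] [L.Structure B]
    [Nonempty A] [Nonempty B] [Countable A] [Countable B]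
    (hA : A ⊨ T) (hB : B ⊨ T)
    (hAatomic : IsAtomicModel T A) (hBatomic : IsAtomicModel T B) :
    Nonempty (A ≃[L] B) := by
  have ext_fst (a : A) :
      IsCofinal {s : FiniteElementaryCorrespondence L A B | ∃ b, (a, b) ∈ s.1} := by
    rintro ⟨s, hfin, hs⟩
    obtain ⟨b, hb⟩ := hs.exists_insert hA hB hAatomic hfin a
    exact ⟨⟨_, hfin.insert _, hb⟩, ⟨b, Set.mem_insert _ _⟩, Set.subset_insert _ _⟩
  have ext_snd (b : B) :
      IsCofinal {s : FiniteElementaryCorrespondence L A B | ∃ a, (a, b) ∈ s.1} := by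
    rintro ⟨s, hfin, hs⟩
    obtain ⟨a, ha⟩ := hs.swap.exists_insert hB hA hBatomic
      (hfin.preimage Prod.swap_injective.injOn) b
    refine ⟨⟨insert (a, b) s, hfin.insert _, ?_⟩, ⟨a, Set.mem_insert _ _⟩, Set.subset_insert _ _⟩
    convert ha.swap using 1
    ext ⟨x, y⟩
    simp [and_comm]
  let D : A ⊕ B → Order.Cofinal (FiniteElementaryCorrespondence L A B) :=
    Sum.elim (fun a => ⟨_, ext_fst a⟩) fun b => ⟨_, ext_snd b⟩
  have : Encodable (A ⊕ B) := Encodable.ofCountable _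
  let I := Order.idealOfCofinals
    (⟨∅, Set.finite_empty, isElementaryCorrespondence_empty hT hA hB⟩ :
      FiniteElementaryCorrespondence L A B) D
  refine (isElementaryCorrespondence_iUnion_ideal I).nonempty_equiv (fun a => ?_) fun b => ?_
  · obtain ⟨s, ⟨b, hb⟩, hs⟩ := Order.cofinal_meets_idealOfCofinals _ D (.inl a)
    exact ⟨b, Set.mem_biUnion hs hb⟩
  · obtain ⟨s, ⟨a, ha⟩, hs⟩ := Order.cofinal_meets_idealOfCofinals _ D (.inr b)
    exact ⟨a, Set.mem_biUnion hs ha⟩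
end

section
/- (Prime ⇒ Atomic) Let L be a countable first-order language and T a complete L-theory. If A is a prime model of T, then A is countable and atomic. -/
open FirstOrder FirstOrder.Language

/-- A model `A` of `T` is prime if it elementarily embeds into every model of `T`. -/
def IsPrimeModel {L : FirstOrder.Language.{u, v}} (T : L.Theory) (A : Type*)
    [L.Structure A] : Prop :=
  ∀ (M : Type (max u v)) [L.Structure M] [Nonempty M], M ⊨ T → Nonempty (A ↪ₑ[L] M)

namespace FirstOrder.Language

open Set Theory

variable {L : FirstOrder.Language.{u, v}} {T : L.Theory}

/-- The truth value of a formula depends only on the values of its free variables. -/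
theorem Formula.realize_congr_of_eqOn_freeVarFinset {α M : Type*} [DecidableEq α] [L.Structure M]
    {φ : L.Formula α} {v w : α → M} (h : ∀ a ∈ φ.freeVarFinset, v a = w a) :
    φ.Realize v ↔ φ.Realize w := by
  have key : ∀ u : α → M, (∀ a ∈ φ.freeVarFinset, v a = u a) →
      ((φ.restrictFreeVar id).Realize (fun a : φ.freeVarFinset => v a) default ↔ φ.Realize u) :=
    fun u hu => BoundedFormula.realize_restrictFreeVar u fun a => hu a a.2
  exact (key v fun _ _ => rfl).symm.trans (key w h)

/-- The image of the set defined by `φ` under restriction of assignments along `j` is defined by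
a formula, uniformly in the structure. -/
theorem Formula.exists_realize_iff_exists_comp {α β : Type*} [Finite β] (φ : L.Formula α)
    (j : β → α) :
    ∃ θ : L.Formula β, ∀ (M : Type w) [L.Structure M] [Nonempty M] (y : β → M),
      θ.Realize y ↔ ∃ v : α → M, φ.Realize v ∧ v ∘ j = y := by
  classical
  let s : Set α := ↑φ.freeVarFinset ∪ range j
  have : Finite s := (φ.freeVarFinset.finite_toSet.union (finite_range j)).to_subtype
  have hs : (φ.freeVarFinset : Set α) ⊆ s := subset_union_left
  let φ' : L.Formula s := φ.restrictFreeVar (Set.inclusion hs)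
  let j' : β → s := fun b => ⟨j b, Or.inr ⟨b, rfl⟩⟩
  refine ⟨Formula.iExs s ((φ'.relabel Sum.inr : L.Formula (β ⊕ s)) ⊓
    Formula.iInf fun b => Term.equal (Term.var (Sum.inr (j' b))) (Term.var (Sum.inl b))), ?_⟩
  intro M _ _ y
  have hφ' (v : α → M) : φ'.Realize (v ∘ (↑)) ↔ φ.Realize v :=
    BoundedFormula.realize_restrictFreeVar' hs
  simp only [Formula.realize_iExs, Formula.realize_inf, Formula.realize_relabel, Sum.elim_comp_inr,
    Formula.realize_iInf, Formula.realize_equal, Term.realize_var, Sum.elim_inr, Sum.elim_inl]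
  constructor
  · rintro ⟨v, hv, hy⟩
    let v' : α → M := fun a => if h : a ∈ s then v ⟨a, h⟩ else Classical.arbitrary M
    have hv' : v' ∘ (↑) = v := by
      ext a
      simp [v']
    refine ⟨v', (hφ' v').1 (hv'.symm ▸ hv), funext fun b => ?_⟩
    rw [← hy, ← hv']
    rfl
  · rintro ⟨v, hv, rfl⟩
    exact ⟨v ∘ (↑), (hφ' v).2 hv, fun b => rfl⟩

namespace Theory.CompleteType

/-- A set of complete types is dense as soon as every formula realized in a model of `T` is realized
by a tuple, possibly in another model of `T`, whose type lies in the set. -/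
theorem dense_of_forall_realize {α : Type w} {D : Set (T.CompleteType α)}
    (h : ∀ (M : ModelType.{u, v, max u v w} T) (v : α → M) (φ : L.Formula α), φ.Realize v →
      ∃ (N : ModelType.{u, v, max u v w} T) (w : α → N), φ.Realize w ∧ T.typeOf w ∈ D) :
    Dense D := by
  rw [_root_.CompleteType.isTopologicalBasis_range_typesWith.dense_iff]
  rintro _ ⟨σ, rfl⟩ ⟨p, hp⟩
  obtain ⟨M, v, rfl⟩ := exists_modelType_is_realized_in T p
  rw [mem_typesWith_iff, mem_typeOf] at hp
  obtain ⟨N, w, hw, hD⟩ := h M v _ hp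
  exact ⟨_, by rwa [mem_typesWith_iff, mem_typeOf], hD⟩

/-- The complete types containing a witness for `χ`, among their own variables, if they assert that
one exists. -/
def withWitness (T : L.Theory) {α : Type w} (χ : L.Formula (α ⊕ Fin 1)) :
    Set (T.CompleteType α) :=
  (T.typesWith (Formula.equivSentence (χ.iExs (Fin 1))))ᶜ ∪
    ⋃ i : α, T.typesWith (Formula.equivSentence (χ.relabel (Sum.elim id fun _ => i)))

theorem isOpen_withWitness {α : Type w} (χ : L.Formula (α ⊕ Fin 1)) : IsOpen (withWitness T χ) :=
  (_root_.CompleteType.isClosed_typesWith _).isOpen_compl.union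
    (isOpen_iUnion fun _ => _root_.CompleteType.isOpen_typesWith _)

theorem typeOf_mem_withWitness {α : Type w} {χ : L.Formula (α ⊕ Fin 1)} {M : Type*}
    [L.Structure M] [Nonempty M] [M ⊨ T] {v : α → M} :
    T.typeOf v ∈ withWitness T χ ↔
      ((∃ m, χ.Realize (Sum.elim v m)) → ∃ i, χ.Realize (Sum.elim v fun _ => v i)) := by
  have (i : α) : v ∘ Sum.elim id (fun _ : Fin 1 => i) = Sum.elim v fun _ => v i := by
    rw [Sum.comp_elim]
    rfl
  simp only [withWitness, mem_union, mem_compl_iff, mem_iUnion, mem_typesWith_iff,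
    formula_mem_typeOf, Formula.realize_iExs, Formula.realize_relabel, this, imp_iff_not_or]

theorem dense_withWitness {α : Type w} [Infinite α] (χ : L.Formula (α ⊕ Fin 1)) :
    Dense (withWitness T χ) := by
  classical
  refine dense_of_forall_realize fun M v φ hφ => ?_
  by_cases hv : ∃ m, χ.Realize (Sum.elim v m)
  swap
  · exact ⟨M, v, hφ, typeOf_mem_withWitness.2 fun h => (hv h).elim⟩
  obtain ⟨m, hm⟩ := hv
  obtain ⟨i, hi⟩ := Infinite.exists_notMem_finset
    (φ.freeVarFinset ∪ χ.freeVarFinset.biUnion (Sum.elim singleton fun _ => ∅))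
  simp only [Finset.mem_union, Finset.mem_biUnion, not_or, not_exists, not_and] at hi
  refine ⟨M, Function.update v i (m 0), ?_, typeOf_mem_withWitness.2 fun _ => ⟨i, ?_⟩⟩
  · refine (Formula.realize_congr_of_eqOn_freeVarFinset fun a ha => ?_).1 hφ
    rw [Function.update_of_ne]
    rintro rfl
    exact hi.1 ha
  · refine (Formula.realize_congr_of_eqOn_freeVarFinset fun a ha => ?_).1 hm
    rcases a with a | a
    · rw [Sum.elim_inl, Sum.elim_inl, Function.update_of_ne]
      rintro rfl
      exact hi.2 _ ha (Finset.mem_singleton_self _)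
    · simp [Subsingleton.elim a 0]

/-- If the type of a sequence contains witnesses for all existential formulas, then its range is
the universe of an elementary substructure. -/
theorem meetsDefinable_range {α : Type w} {M : Type*} [L.Structure M] [Nonempty M] [M ⊨ T]
    {v : α → M} (h : ∀ χ : L.Formula (α ⊕ Fin 1), T.typeOf v ∈ withWitness T χ) :
    L.MeetsDefinable (range v) := by
  rintro D ⟨x, hx⟩ hD
  obtain ⟨φ, hφ⟩ := definable_iff_exists_formula_sum.1 hD
  choose j hj using fun a : range v => a.2
  have key (m : Fin 1 → M) :
      (φ.relabel (Sum.map j id)).Realize (Sum.elim v m) ↔ m 0 ∈ D := by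
    have h1 : Sum.elim v m ∘ Sum.map j id = Sum.elim (fun a : range v => (a : M)) m := by
      ext a
      rcases a with a | a <;> simp [hj]
    rw [Formula.realize_relabel, h1]
    exact (Set.ext_iff.1 hφ m).symm
  obtain ⟨i, hi⟩ := typeOf_mem_withWitness.1 (h (φ.relabel (Sum.map j id)))
    ⟨fun _ => x, (key _).2 hx⟩
  exact ⟨v i, (key _).1 hi, mem_range_self i⟩

/-- A satisfiable theory in a countable language has a model enumerated by a sequence whose type
lies in any given countable family of dense open sets. -/
theorem exists_surjective_typeOf_mem [Countable L.Symbols] (hT : T.IsSatisfiable) {ι : Type*}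
    [Countable ι] (D : ι → Set (T.CompleteType ℕ)) (hDo : ∀ i, IsOpen (D i))
    (hDd : ∀ i, Dense (D i)) :
    ∃ (M : ModelType.{u, v, max u v} T) (v : ℕ → M),
      Function.Surjective v ∧ ∀ i, T.typeOf v ∈ D i := by
  have : Nonempty (T.CompleteType ℕ) := nonempty_iff.2 hT
  have hdense : Dense (⋂ k : L.Formula (ℕ ⊕ Fin 1) ⊕ ι, Sum.elim (withWitness T) D k) := by
    refine dense_iInter_of_isOpen ?_ ?_ <;> rintro (χ | i)
    exacts [isOpen_withWitness χ, hDo i, dense_withWitness χ, hDd i]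
  obtain ⟨q, hq⟩ := hdense.nonempty
  rw [mem_iInter] at hq
  obtain ⟨M, v, rfl⟩ := exists_modelType_is_realized_in T q
  have hM := meetsDefinable_range fun χ => hq (Sum.inl χ)
  let S := hM.toElementarySubstructure
  have hS : (S : Set M) = range v := hM.closure_eq_self
  let w : ℕ → S := fun n => ⟨v n, SetLike.mem_coe.1 (hS ▸ mem_range_self n)⟩
  have : S ⊨ T := S.theory_model
  refine ⟨ModelType.of T S, w, ?_, fun i => ?_⟩
  · rintro ⟨x, hx⟩
    obtain ⟨n, rfl⟩ : x ∈ range v := hS ▸ SetLike.mem_coe.2 hx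
    exact ⟨n, rfl⟩
  · have hw : T.typeOf w = T.typeOf v := by
      refine SetLike.ext fun σ => ?_
      rw [mem_typeOf, mem_typeOf]
      exact (S.subtype.map_formula _ w).symm
    exact hw ▸ hq (Sum.inr i)

end Theory.CompleteType

end FirstOrder.Language

open Set Theory CompleteType in
/-- If no complete formula is realized by `a`, then the types of sequences whose `j`-subtuple does
not have the same type as `a` are dense. -/
theorem dense_iUnion_typesWith_not_of_forall_not_isCompleteFormula
    {L : FirstOrder.Language.{u, v}} {T : L.Theory} {A : Type w} [L.Structure A]
    {n : ℕ} {a : Fin n → A}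
    (ha : ∀ φ : L.Formula (Fin n), IsCompleteFormula T φ → ¬ φ.Realize a) (j : Fin n → ℕ) :
    Dense (⋃ ψ : {ψ : L.Formula (Fin n) // ψ.Realize a},
      T.typesWith (Formula.equivSentence (ψ.1.relabel j).not)) := by
  refine dense_of_forall_realize fun M v φ hφ => ?_
  obtain ⟨θ, hθ⟩ := Formula.exists_realize_iff_exists_comp φ j
  have hθv : θ.Realize (v ∘ j) := (hθ M _).2 ⟨v, hφ, rfl⟩
  have hψ : ∃ ψ : L.Formula (Fin n), ψ.Realize a ∧ ¬ T ⊨ᵇ θ.imp ψ := by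
    by_contra! h
    have hθψ (ψ : L.Formula (Fin n)) : T ⊨ᵇ θ.imp ψ → ¬ T ⊨ᵇ θ.imp ψ.not := fun h₁ h₂ =>
      h₂ M _ default hθv (h₁ M _ default hθv)
    refine ha θ (fun ψ => ?_) ?_
    · by_cases hψ : ψ.Realize a
      exacts [Or.inl ⟨h ψ hψ, hθψ ψ (h ψ hψ)⟩,
        Or.inr ⟨h ψ.not hψ, fun h₁ => hθψ ψ h₁ (h ψ.not hψ)⟩]
    · by_contra hθa
      exact h θ.not hθa M _ default hθv hθv
  obtain ⟨ψ, hψa, hψ⟩ := hψ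
  simp only [ModelsBoundedFormula, not_forall, BoundedFormula.realize_imp] at hψ
  obtain ⟨N, y, xs, hθy, hψy⟩ := hψ
  obtain rfl := Subsingleton.elim xs default
  obtain ⟨w, hw, rfl⟩ := (hθ N y).1 hθy
  refine ⟨N, w, hw, mem_iUnion.2 ⟨⟨ψ, hψa⟩, ?_⟩⟩
  rw [mem_typesWith_iff, formula_mem_typeOf, Formula.realize_not, Formula.realize_relabel]
  exact hψy

/-- (Prime ⇒ Atomic) A prime model of a complete theory in a countable language is
countable and atomic. -/
theorem prime_implies_atomic {L : FirstOrder.Language.{u, v}} [Countable L.Symbols]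
    {T : L.Theory} (hT : T.IsComplete)
    (A : Type w) [L.Structure A] [Nonempty A]
    (hA : A ⊨ T) (hAprime : IsPrimeModel T A) :
    Countable A ∧ IsAtomicModel T A := by
  constructor
  · obtain ⟨M, v, hv, -⟩ := Theory.CompleteType.exists_surjective_typeOf_mem hT.1
      (fun i : Empty => i.elim) (fun i => i.elim) (fun i => i.elim)
    have : Countable M := hv.countable
    obtain ⟨f⟩ := hAprime M M.is_model
    exact f.injective.countable
  · intro n a
    by_contra! ha
    obtain ⟨M, v, hv, hM⟩ := Theory.CompleteType.exists_surjective_typeOf_mem hT.1 _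
      (fun j : Fin n → ℕ => isOpen_iUnion fun _ => CompleteType.isOpen_typesWith _)
      (dense_iUnion_typesWith_not_of_forall_not_isCompleteFormula ha)
    obtain ⟨f⟩ := hAprime M M.is_model
    choose j hj using fun i => hv (f (a i))
    obtain ⟨⟨ψ, hψa⟩, hψ⟩ := Set.mem_iUnion.1 (hM j)
    rw [Theory.CompleteType.mem_typesWith_iff, Theory.CompleteType.formula_mem_typeOf,
      Formula.realize_not, Formula.realize_relabel, show v ∘ j = f ∘ a from funext hj,
      f.map_formula] at hψ
    exact hψ hψa
end

section
/- There exist a first-order language L whose symbol sets are encodable and a complete, decidable L-theory T that has an atomic model, together with a computable function f from ℕ to codes of L-formulas in one free variable, such that for every i ∈ ℕ, the formula coded by f(i) is a complete formula for T if and only if the i-th partial computable function diverges on input i. In particular, the complement of the halting set {i : the i-th partial computable function halts on i} many-one reduces to the set of codes of complete formulas for T, so that set is Π⁰₁-complete. -/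
open FirstOrder FirstOrder.Language

/-- The code of a formula `φ` with free variables among `x₀, …, x_{n-1}`, obtained from the
standard encoding of formulas as lists of symbols, paired with the arity `n`. -/
def fmlCode {L : FirstOrder.Language.{0, 0}}
    [∀ k, Encodable (L.Functions k)] [∀ k, Encodable (L.Relations k)]
    {n : ℕ} (φ : L.Formula (Fin n)) : ℕ :=
  Nat.pair n (Encodable.encode φ.listEncode)

/-- The code of a sentence, via the standard encoding of formulas as lists of symbols. -/
def sentenceCode {L : FirstOrder.Language.{0, 0}}
    [∀ k, Encodable (L.Functions k)] [∀ k, Encodable (L.Relations k)]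
    (σ : L.Sentence) : ℕ :=
  Encodable.encode σ.listEncode

/-- A theory `T` is decidable if the set of codes of sentences in `T` is computable. -/
def IsDecidableTheory {L : FirstOrder.Language.{0, 0}}
    [∀ k, Encodable (L.Functions k)] [∀ k, Encodable (L.Relations k)]
    (T : L.Theory) : Prop :=
  ∃ f : ℕ → Bool, Computable f ∧ ∀ σ : L.Sentence, (f (sentenceCode σ) = true ↔ σ ∈ T)

namespace ColorTheory

/-- The relation symbols of the language: unary predicates indexed by the natural numbers. -/
inductive UnaryRel : ℕ → Type
  | color (m : ℕ) : UnaryRel 1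

instance (k : ℕ) : Encodable (UnaryRel k) where
  encode
    | .color m => m
  decode n :=
    match k with
    | 1 => some (.color n)
    | _ => none
  encodek := by
    rintro ⟨⟩
    rfl

/-- The language with countably many unary predicates and no other symbols. -/
def lang : FirstOrder.Language.{0, 0} := ⟨fun _ => Empty, UnaryRel⟩

instance (k : ℕ) : Encodable (lang.Functions k) := inferInstanceAs (Encodable Empty)

instance (k : ℕ) : Encodable (lang.Relations k) := inferInstanceAs (Encodable (UnaryRel k))

/-- The `m`-th unary predicate. -/
def color (m : ℕ) : lang.Relations 1 := UnaryRel.color m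

/-- `x` satisfies the `m`-th unary predicate. -/
def Has {M : Type} [lang.Structure M] (m : ℕ) (x : M) : Prop :=
  Structure.RelMap (color m) fun _ => x

theorem term_eq_var {β : Type*} (t : lang.Term β) : ∃ b, t = Term.var b := by
  cases t with
  | var b => exact ⟨b, rfl⟩
  | func f _ => exact Empty.elim f

/-! ### The standard colours -/

/-- The `i`-th program has halted on input `i` within `s` steps. -/
def halted (s i : ℕ) : Bool :=
  (Nat.Partrec.Code.evaln s (Denumerable.ofNat Nat.Partrec.Code i) i).isSome

/-- The value of the `m`-th predicate at the colour `(i, b)`: the predicate `2 * j` selects the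
colours with first component `j`, and the predicate `2 * s + 1` selects the colours `(i, true)`
such that the `i`-th program halts within `s` steps. -/
def val (i : ℕ) (b : Bool) (m : ℕ) : Bool :=
  bif m.bodd then b && halted m.div2 i else decide (m.div2 = i)

theorem val_even (i j : ℕ) (b : Bool) : val i b (2 * j) = decide (j = i) := by
  simp [val, Nat.bodd_mul, Nat.div2_val]

theorem val_odd (i s : ℕ) (b : Bool) : val i b (2 * s + 1) = (b && halted s i) := by
  simp [val, Nat.bodd_mul, Nat.div2_val]

theorem lt_of_halted {s i : ℕ} (h : halted s i = true) : i < s := by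
  obtain ⟨x, hx⟩ := Option.isSome_iff_exists.1 h
  exact Nat.Partrec.Code.evaln_bound (Option.mem_def.2 hx)

theorem dom_iff_halted (i : ℕ) :
    ((Nat.Partrec.Code.eval (Denumerable.ofNat Nat.Partrec.Code i)) i).Dom ↔
      ∃ s, halted s i = true := by
  simp only [Part.dom_iff_mem, Nat.Partrec.Code.evaln_complete, halted,
    Option.isSome_iff_exists, Option.mem_def]
  exact exists_comm

/-- Colours agreeing on a suitable finite set of predicates agree on all of them. -/
theorem exists_val_determined (i : ℕ) (b : Bool) :
    ∃ K, ∀ i' b', (∀ m < K, val i b m = val i' b' m) → val i b = val i' b' := by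
  by_cases h : ∃ s, halted s i = true
  · obtain ⟨s, hs⟩ := h
    refine ⟨max (2 * i + 1) (2 * s + 2), fun i' b' hm => ?_⟩
    have h1 := hm (2 * i) (by omega)
    have h2 := hm (2 * s + 1) (by omega)
    simp only [val_even, decide_true, Bool.true_eq, decide_eq_true_eq] at h1
    subst h1
    simp only [val_odd, hs, Bool.and_true] at h2
    rw [h2]
  · refine ⟨2 * i + 1, fun i' b' hm => ?_⟩
    have h1 := hm (2 * i) (by omega)
    simp only [val_even, decide_true, Bool.true_eq, decide_eq_true_eq] at h1
    subst h1
    simp only [not_exists, Bool.not_eq_true] at h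
    funext m
    simp [val, h]

/-- Some standard colour realizes the pattern `w` on the first `w.length` predicates. -/
def Consistent (w : List Bool) : Prop :=
  ∃ i < w.length + 1, w = (List.range w.length).map (val i true) ∨
    w = (List.range w.length).map (val i false)

theorem Consistent.exists_val {w : List Bool} (h : Consistent w) :
    ∃ i b, w = (List.range w.length).map (val i b) := by
  obtain ⟨i, -, h | h⟩ := h
  exacts [⟨i, _, h⟩, ⟨i, _, h⟩]

theorem consistent_map_val (K i : ℕ) (b : Bool) : Consistent ((List.range K).map (val i b)) := by
  by_cases hi : i < K + 1
  · refine ⟨i, by simpa using hi, ?_⟩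
    cases b <;> simp
  · refine ⟨K, by simp, Or.inr ?_⟩
    simp only [List.length_map, List.length_range, List.map_inj_left, List.mem_range]
    intro m hm
    obtain ⟨j, rfl | rfl⟩ := m.even_or_odd'
    · rw [val_even, val_even, decide_eq_decide]
      omega
    · have : halted j i = false := by
        by_contra hj
        have := lt_of_halted (Bool.not_eq_false _ ▸ hj)
        omega
      simp [val_odd, this]

/-! ### Back and forth -/

/-- The element `y` realizes the pattern `w` on the first `w.length` predicates. -/
def Pattern {M : Type} [lang.Structure M] (w : List Bool) (y : M) : Prop :=
  ∀ m < w.length, (Has m y ↔ w.getD m false = true)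

open Classical in
theorem exists_pattern {M : Type} [lang.Structure M] (K : ℕ) (y : M) :
    ∃ w : List Bool, w.length = K ∧ Pattern w y :=
  ⟨(List.range K).map fun m => decide (Has m y), by simp, fun m hm => by
    have : m < K := by simpa using hm
    simp [List.getD_eq_getElem?_getD, this]⟩

/-- Each consistent pattern is realized infinitely often, and no other pattern is realized. -/
structure Good (M : Type) [lang.Structure M] : Prop where
  infinite : ∀ w, Consistent w → {y : M | Pattern w y}.Infinite
  consistent : ∀ w, (∃ y : M, Pattern w y) → Consistent w

/-- Two tuples satisfy the same equalities and the same predicates with index below `K`. -/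
def Agree {M N ι : Type} [lang.Structure M] [lang.Structure N] (K : ℕ) (p : ι → M) (q : ι → N) :
    Prop :=
  (∀ i j, p i = p j ↔ q i = q j) ∧ ∀ i, ∀ m < K, (Has m (p i) ↔ Has m (q i))

section BackAndForth

variable {M N ι : Type} [lang.Structure M] [lang.Structure N]

theorem Agree.symm {K : ℕ} {p : ι → M} {q : ι → N} (h : Agree K p q) : Agree K q p :=
  ⟨fun i j => (h.1 i j).symm, fun i m hm => (h.2 i m hm).symm⟩

theorem Agree.mono {K K' : ℕ} {p : ι → M} {q : ι → N} (h : Agree K p q) (hK : K' ≤ K) :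
    Agree K' p q :=
  ⟨h.1, fun i m hm => h.2 i m (hm.trans_le hK)⟩

theorem Agree.exists_extend [Finite ι] (hM : Good M) (hN : Good N) {K : ℕ} {p : ι → M} {q : ι → N}
    (h : Agree K p q) (x : M) :
    ∃ y : N, (∀ i, p i = x ↔ q i = y) ∧ ∀ m < K, (Has m x ↔ Has m y) := by
  by_cases hx : ∃ i, p i = x
  · obtain ⟨i, rfl⟩ := hx
    exact ⟨q i, fun j => h.1 j i, h.2 i⟩
  · obtain ⟨w, rfl, hw⟩ := exists_pattern K x
    obtain ⟨y, hy, hyq⟩ := ((hN.infinite w (hM.consistent w ⟨x, hw⟩)).sdiff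
      (Set.finite_range q)).nonempty
    exact ⟨y, fun i => iff_of_false (fun e => hx ⟨i, e⟩) fun e => hyq ⟨i, e⟩,
      fun m hm => (hw m hm).trans (hy m hm).symm⟩

theorem Agree.snoc {α : Type} {K n : ℕ} {v : α → M} {xs : Fin n → M} {v' : α → N} {ys : Fin n → N}
    (h : Agree K (Sum.elim v xs) (Sum.elim v' ys)) {x : M} {y : N}
    (hxy : ∀ i, Sum.elim v xs i = x ↔ Sum.elim v' ys i = y)
    (hK : ∀ m < K, (Has m x ↔ Has m y)) :
    Agree K (Sum.elim v (Fin.snoc xs x : Fin (n + 1) → M))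
      (Sum.elim v' (Fin.snoc ys y : Fin (n + 1) → N)) := by
  have key : ∀ i : α ⊕ Fin (n + 1),
      (∃ j, Sum.elim v (Fin.snoc xs x : Fin (n + 1) → M) i = Sum.elim v xs j ∧
        Sum.elim v' (Fin.snoc ys y : Fin (n + 1) → N) i = Sum.elim v' ys j) ∨
      (Sum.elim v (Fin.snoc xs x : Fin (n + 1) → M) i = x ∧
        Sum.elim v' (Fin.snoc ys y : Fin (n + 1) → N) i = y) := by
    rintro (a | i)
    · exact Or.inl ⟨Sum.inl a, rfl, rfl⟩
    · refine Fin.lastCases ?_ (fun i => ?_) i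
      · right; simp
      · left; exact ⟨Sum.inr i, by simp, by simp⟩
  refine ⟨fun i j => ?_, fun i m hm => ?_⟩
  · obtain ⟨i', hi, hi'⟩ | ⟨hi, hi'⟩ := key i <;> obtain ⟨j', hj, hj'⟩ | ⟨hj, hj'⟩ := key j <;>
      rw [hi, hi', hj, hj']
    · exact h.1 i' j'
    · exact hxy i'
    · rw [eq_comm, hxy j', eq_comm]
    · simp
  · obtain ⟨i', hi, hi'⟩ | ⟨hi, hi'⟩ := key i <;> rw [hi, hi']
    exacts [h.2 i' m hm, hK m hm]

/-- The truth of a formula at a tuple depends only on the equalities in the tuple and on finitely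
many predicates. -/
theorem exists_agree_realize (hM : Good M) (hN : Good N) {α : Type} [Finite α] {n : ℕ}
    (φ : lang.BoundedFormula α n) :
    ∃ K, ∀ (v : α → M) (xs : Fin n → M) (v' : α → N) (ys : Fin n → N),
      Agree K (Sum.elim v xs) (Sum.elim v' ys) → (φ.Realize v xs ↔ φ.Realize v' ys) := by
  induction φ with
  | falsum => exact ⟨0, fun _ _ _ _ _ => Iff.rfl⟩
  | equal t₁ t₂ =>
    obtain ⟨b₁, rfl⟩ := term_eq_var t₁
    obtain ⟨b₂, rfl⟩ := term_eq_var t₂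
    exact ⟨0, fun _ _ _ _ h => h.1 b₁ b₂⟩
  | rel R ts =>
    cases R with
    | color m =>
      obtain ⟨b, hb⟩ := term_eq_var (ts 0)
      obtain rfl : ts = fun _ => Term.var b := by
        funext i
        rw [Subsingleton.elim i 0, hb]
      exact ⟨m + 1, fun _ _ _ _ h => h.2 b m m.lt_succ_self⟩
  | imp φ ψ ihφ ihψ =>
    obtain ⟨K₁, h₁⟩ := ihφ
    obtain ⟨K₂, h₂⟩ := ihψ
    refine ⟨max K₁ K₂, fun v xs v' ys h => ?_⟩
    rw [BoundedFormula.realize_imp, BoundedFormula.realize_imp,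
      h₁ v xs v' ys (h.mono (le_max_left _ _)), h₂ v xs v' ys (h.mono (le_max_right _ _))]
  | all φ ih =>
    obtain ⟨K, hK⟩ := ih
    refine ⟨K, fun v xs v' ys h => ?_⟩
    rw [BoundedFormula.realize_all, BoundedFormula.realize_all]
    constructor
    · intro hφ y
      obtain ⟨x, hx, hm⟩ := h.symm.exists_extend hN hM y
      exact (hK _ _ _ _ (h.snoc (fun i => (hx i).symm) fun m hlt => (hm m hlt).symm)).1 (hφ x)
    · intro hφ x
      obtain ⟨y, hy, hm⟩ := h.exists_extend hM hN x
      exact (hK _ _ _ _ (h.snoc hy hm)).2 (hφ y)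

theorem realize_iff_of_agree (hM : Good M) (hN : Good N) {α : Type} [Finite α]
    (φ : lang.Formula α) {v : α → M} {v' : α → N} (h : ∀ K, Agree K v v') :
    φ.Realize v ↔ φ.Realize v' := by
  obtain ⟨K, hK⟩ := exists_agree_realize hM hN φ
  refine hK _ _ _ _ ⟨?_, ?_⟩
  · rintro (i | i) (j | j)
    exacts [(h 0).1 i j, j.elim0, i.elim0, i.elim0]
  · rintro (i | i)
    exacts [(h K).2 i, i.elim0]

theorem Good.exists_val (hM : Good M) (x : M) (K : ℕ) :
    ∃ i b, ∀ m < K, (Has m x ↔ val i b m = true) := by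
  obtain ⟨w, rfl, hw⟩ := exists_pattern K x
  obtain ⟨i, b, h⟩ := (hM.consistent w ⟨x, hw⟩).exists_val
  refine ⟨i, b, fun m hm => (hw m hm).trans ?_⟩
  rw [h]
  simp [List.getD_eq_getElem?_getD, hm]

/-- An element matching a standard colour on a determining set of predicates matches it on all. -/
theorem Good.has_iff_val (hM : Good M) {x : M} {i K : ℕ} {b : Bool}
    (hK : ∀ i' b', (∀ m < K, val i b m = val i' b' m) → val i b = val i' b')
    (hx : ∀ m < K, (Has m x ↔ val i b m = true)) (m : ℕ) : Has m x ↔ val i b m = true := by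
  obtain ⟨i', b', h⟩ := hM.exists_val x (max K (m + 1))
  rw [h m (by omega), hK i' b' fun l hl => ?_]
  exact Bool.eq_iff_iff.2 ((hx l hl).symm.trans (h l (by omega)))

end BackAndForth

/-! ### The atomic model -/

/-- The atomic model: infinitely many elements of each standard colour. -/
abbrev Std : Type := (ℕ × Bool) × ℕ

instance : lang.Structure Std where
  funMap f := Empty.elim f
  RelMap {n} R := match n, R with
    | _, .color m => fun a => val (a 0).1.1 (a 0).1.2 m = true

theorem has_std (m : ℕ) (x : Std) : Has m x ↔ val x.1.1 x.1.2 m = true := Iff.rfl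

theorem good_std : Good Std where
  infinite w hw := by
    obtain ⟨i, b, h⟩ := hw.exists_val
    refine Set.infinite_of_injective_forall_mem (f := fun j : ℕ => (((i, b), j) : Std))
      (fun j j' e => (Prod.ext_iff.1 e).2) fun j m hm => ?_
    rw [has_std, h]
    simp [List.getD_eq_getElem?_getD, hm]
  consistent := by
    rintro w ⟨⟨⟨i, b⟩, j⟩, hw⟩
    have : w = (List.range w.length).map (val i b) := by
      refine List.ext_getElem (by simp) fun m hm _ => ?_
      have := hw m hm
      rw [has_std] at this
      simpa [List.getD_eq_getElem?_getD, hm] using (Bool.eq_iff_iff.2 this).symm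
    rw [this]
    exact consistent_map_val _ i b

/-! ### The axioms -/

/-- The last variable satisfies the `m`-th predicate if `b` holds, and fails it otherwise. -/
def literal (k m : ℕ) (b : Bool) : lang.BoundedFormula Empty (k + 1) :=
  bif b then .rel (color m) fun _ => .var (.inr (Fin.last k))
  else (BoundedFormula.rel (color m) fun _ => .var (.inr (Fin.last k))).imp .falsum

/-- The last variable realizes the pattern `w`, as a list of formulas. -/
def literals (k : ℕ) (w : List Bool) : List (lang.BoundedFormula Empty (k + 1)) :=
  (List.range w.length).map fun m => literal k m (w.getD m false)

/-- The last variable differs from all others, as a list of formulas. -/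
def distinct (k : ℕ) : List (lang.BoundedFormula Empty (k + 1)) :=
  (List.finRange k).map fun j =>
    (BoundedFormula.equal (.var (.inr (Fin.last k))) (.var (.inr j.castSucc))).imp .falsum

open Classical in
/-- The sentence saying that more than `k` elements realize the pattern `w` if `w` is consistent,
and that no element does otherwise. -/
noncomputable def patternSentence (k : ℕ) (w : List Bool) : lang.Sentence :=
  if Consistent w then
    (((distinct k ++ literals k w).foldr BoundedFormula.imp .falsum).all.imp .falsum).alls
  else ((literals k w).foldr BoundedFormula.imp .falsum).all.alls

/-- The pattern mentioned by the `k`-th axiom; each pattern is mentioned infinitely often. -/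
def patternOf (k : ℕ) : List Bool := (Encodable.decode k.unpair.1).getD []

/-- The theory saying that each consistent pattern is realized infinitely often and that no other
pattern is realized. -/
def theory : lang.Theory := Set.range fun k => patternSentence k (patternOf k)

section Model

variable {M : Type} [lang.Structure M]

theorem realize_literals {k : ℕ} {w : List Bool} {v : Empty → M} {xs : Fin k → M} {y : M} :
    (∀ φ ∈ literals k w, φ.Realize v (Fin.snoc xs y)) ↔ Pattern w y := by
  simp only [literals, List.mem_map, List.mem_range, forall_exists_index, and_imp,
    forall_apply_eq_imp_iff₂, Pattern]
  refine forall₂_congr fun m _ => ?_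
  cases w.getD m false <;>
    simp [literal, Has, BoundedFormula.Realize]

theorem realize_distinct {k : ℕ} {v : Empty → M} {xs : Fin k → M} {y : M} :
    (∀ φ ∈ distinct k, φ.Realize v (Fin.snoc xs y)) ↔ y ∉ Set.range xs := by
  simp [distinct, BoundedFormula.Realize, eq_comm]

theorem realize_patternSentence_of_consistent {k : ℕ} {w : List Bool} (hw : Consistent w) :
    M ⊨ patternSentence k w ↔ ∀ xs : Fin k → M, ∃ y ∉ Set.range xs, Pattern w y := by
  rw [patternSentence, if_pos hw, Sentence.Realize, BoundedFormula.realize_alls]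
  refine forall_congr' fun xs => ?_
  simp only [BoundedFormula.realize_imp, BoundedFormula.realize_all,
    BoundedFormula.realize_foldr_imp, List.mem_append, or_imp, forall_and, realize_distinct,
    realize_literals]
  simp [BoundedFormula.Realize]

theorem realize_patternSentence_of_not_consistent [Nonempty M] {k : ℕ} {w : List Bool}
    (hw : ¬ Consistent w) : M ⊨ patternSentence k w ↔ ∀ y : M, ¬ Pattern w y := by
  rw [patternSentence, if_neg hw, Sentence.Realize, BoundedFormula.realize_alls]
  simp only [BoundedFormula.realize_all, BoundedFormula.realize_foldr_imp, realize_literals]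
  simp [BoundedFormula.Realize]

theorem exists_patternOf_eq (w : List Bool) (n : ℕ) : ∃ k, n ≤ k ∧ patternOf k = w :=
  ⟨Nat.pair (Encodable.encode w) n, Nat.right_le_pair _ _, by simp [patternOf]⟩

theorem model_theory_iff_good [Nonempty M] : M ⊨ theory ↔ Good M := by
  simp only [theory, Theory.model_iff, Set.forall_mem_range]
  constructor
  · intro h
    refine ⟨fun w hw hfin => ?_, fun w hex => ?_⟩
    · obtain ⟨k, hk, rfl⟩ := exists_patternOf_eq w hfin.toFinset.card
      classical
      obtain ⟨x⟩ := ‹Nonempty M›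
      let xs : Fin k → M := fun j =>
        if hj : j < hfin.toFinset.card then (hfin.toFinset.equivFin.symm ⟨j, hj⟩ : M) else x
      obtain ⟨y, hy, hyw⟩ := (realize_patternSentence_of_consistent hw).1 (h k) xs
      have hmem : y ∈ hfin.toFinset := by simpa using hyw
      refine hy ⟨Fin.castLE hk (hfin.toFinset.equivFin ⟨y, hmem⟩), ?_⟩
      simp [xs]
    · obtain ⟨k, -, rfl⟩ := exists_patternOf_eq w 0
      by_contra hw
      obtain ⟨y, hy⟩ := hex
      exact (realize_patternSentence_of_not_consistent hw).1 (h k) y hy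
  · intro h k
    by_cases hw : Consistent (patternOf k)
    · rw [realize_patternSentence_of_consistent hw]
      intro xs
      obtain ⟨y, hy, hyx⟩ := ((h.infinite _ hw).sdiff (Set.finite_range xs)).nonempty
      exact ⟨y, hyx, hy⟩
    · rw [realize_patternSentence_of_not_consistent hw]
      exact fun y hy => hw (h.consistent _ ⟨y, hy⟩)

end Model

instance : Std ⊨ theory := model_theory_iff_good.2 good_std

theorem isComplete_theory : theory.IsComplete := by
  refine ⟨Theory.Model.isSatisfiable Std, fun σ => ?_⟩
  have key (M : theory.ModelType) : M ⊨ σ ↔ Std ⊨ σ :=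
    realize_iff_of_agree (model_theory_iff_good.1 M.is_model) good_std σ fun _ =>
      ⟨fun i => i.elim, fun i => i.elim⟩
  by_cases h : Std ⊨ σ
  · exact Or.inl (Theory.models_sentence_iff.2 fun M => (key M).2 h)
  · exact Or.inr (Theory.models_sentence_iff.2 fun M => mt (key M).1 h)

/-! ### Complete formulas -/

theorem isCompleteFormula_of_agree {n : ℕ} {φ : lang.Formula (Fin n)} {a : Fin n → Std}
    (ha : φ.Realize a)
    (h : ∀ (M : Type) [lang.Structure M] (v : Fin n → M), Good M → φ.Realize v →
      ∀ K, Agree K a v) :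
    IsCompleteFormula theory φ := by
  intro ψ
  have key (χ : lang.Formula (Fin n)) : theory ⊨ᵇ φ.imp χ ↔ χ.Realize a := by
    constructor
    · intro hχ
      exact (hχ.realize_formula Std (v := a)) ha
    · intro hχ
      refine Theory.models_formula_iff.2 fun M v hv => ?_
      have hM : Good M := model_theory_iff_good.1 M.is_model
      exact (realize_iff_of_agree good_std hM χ (h M v hM hv)).1 hχ
  rw [key, key, Formula.realize_not]
  by_cases hψ : ψ.Realize a
  · exact Or.inl ⟨hψ, not_not.2 hψ⟩
  · exact Or.inr ⟨hψ, hψ⟩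

/-- The variable `x j` satisfies the `m`-th predicate. -/
def colorFormula {n : ℕ} (m : ℕ) (j : Fin n) : lang.Formula (Fin n) :=
  .rel (color m) fun _ => .var (.inl j)

theorem realize_colorFormula {M : Type} [lang.Structure M] {n : ℕ} {m : ℕ} {j : Fin n}
    {v : Fin n → M} : (colorFormula m j).Realize v ↔ Has m (v j) := Iff.rfl

open Classical in
theorem exists_isCompleteFormula_realize {n : ℕ} (a : Fin n → Std) :
    ∃ φ : lang.Formula (Fin n), IsCompleteFormula theory φ ∧ φ.Realize a := by
  choose K hK using fun j => exists_val_determined (a j).1.1 (a j).1.2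
  let eqs : lang.Formula (Fin n) := Formula.iInf fun p : Fin n × Fin n =>
    if a p.1 = a p.2 then (Term.var p.1).equal (Term.var p.2)
    else ((Term.var p.1).equal (Term.var p.2)).not
  let cols : lang.Formula (Fin n) := Formula.iInf fun p : Σ j : Fin n, Fin (K j) =>
    if Has p.2 (a p.1) then colorFormula p.2 p.1 else (colorFormula p.2 p.1).not
  have heqs (M : Type) [lang.Structure M] (v : Fin n → M) :
      eqs.Realize v ↔ ∀ i j, a i = a j ↔ v i = v j := by
    simp only [eqs, Formula.realize_iInf, Prod.forall]
    refine forall₂_congr fun i j => ?_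
    split_ifs with h <;> simp [h]
  have hcols (M : Type) [lang.Structure M] (v : Fin n → M) :
      cols.Realize v ↔ ∀ j, ∀ m < K j, (Has m (a j) ↔ Has m (v j)) := by
    simp only [cols, Formula.realize_iInf, Sigma.forall, Fin.forall_iff]
    refine forall_congr' fun j => forall₂_congr fun m _ => ?_
    split_ifs with h <;> simp [h, realize_colorFormula]
  have ha : (eqs ⊓ cols).Realize a :=
    Formula.realize_inf.2 ⟨(heqs _ a).2 fun _ _ => Iff.rfl, (hcols _ a).2 fun _ _ _ => Iff.rfl⟩
  refine ⟨eqs ⊓ cols, isCompleteFormula_of_agree ha fun M _ v hM hv L => ?_, ha⟩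
  obtain ⟨h₁, h₂⟩ := Formula.realize_inf.1 hv
  rw [heqs] at h₁
  rw [hcols] at h₂
  exact ⟨h₁, fun j m _ => (has_std m (a j)).trans (hM.has_iff_val (hK j)
    (fun l hl => (h₂ j l hl).symm.trans (has_std l (a j))) m).symm⟩

theorem isCompleteFormula_colorFormula_iff (i : ℕ) :
    IsCompleteFormula theory (colorFormula (2 * i) (0 : Fin 1)) ↔
      ¬ ((Nat.Partrec.Code.eval (Denumerable.ofNat Nat.Partrec.Code i)) i).Dom := by
  rw [dom_iff_halted]
  constructor
  · rintro h ⟨s, hs⟩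
    have hφ (b : Bool) : (colorFormula (2 * i) (0 : Fin 1)).Realize
        (fun _ => (((i, b), 0) : Std)) := by
      rw [realize_colorFormula, has_std, val_even]
      simp
    have hψ (b : Bool) : (colorFormula (2 * s + 1) (0 : Fin 1)).Realize
        (fun _ => (((i, b), 0) : Std)) ↔ b = true := by
      rw [realize_colorFormula, has_std, val_odd]
      simp [hs]
    obtain ⟨h, -⟩ | ⟨h, -⟩ := h (colorFormula (2 * s + 1) 0)
    · exact Bool.false_ne_true ((hψ false).1 (h.realize_formula Std (hφ false)))
    · exact h.realize_formula Std (hφ true) ((hψ true).2 rfl)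
  · intro h
    simp only [not_exists, Bool.not_eq_true] at h
    have hval (b b' : Bool) : val i b = val i b' := by
      funext m
      simp [val, h]
    refine isCompleteFormula_of_agree (a := fun _ => ((i, false), 0))
      (by rw [realize_colorFormula, has_std, val_even]; simp) fun M _ v hM hv K => ?_
    refine ⟨fun j l => by simp [Subsingleton.elim j l], fun j m _ => ?_⟩
    obtain ⟨i', b, hm⟩ := hM.exists_val (v 0) (max (2 * i + 1) (m + 1))
    have hi := (hm (2 * i) (by omega)).1 hv
    rw [val_even, decide_eq_true_eq] at hi
    subst hi
    rw [Subsingleton.elim j 0, hm m (by omega), has_std, hval]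

/-! ### Computability -/

theorem encode_list_eq_encode_map {β : Type*} [Encodable β] (l : List β) :
    Encodable.encode l = Encodable.encode (l.map Encodable.encode) := by
  induction l with
  | nil => rfl
  | cons a l ih => simp [Encodable.encode_list_cons, ih]

/-- The code of the symbol standing for the number `n`. -/
def natCode (n : ℕ) : ℕ := 2 * (2 * n + 1) + 1

/-- The code of the `m`-th predicate. -/
def colorCode (m : ℕ) : ℕ := 2 * (2 * Nat.pair 1 m) + 1

/-- The code of the bound variable `i` among `n`. -/
def varCode (n i : ℕ) : ℕ := 2 * Nat.pair n (Nat.succ (Nat.pair (2 * (2 * i + 1)) 0))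

/-- The codes of the symbols in the formula `literal k m b`. -/
def literalCodes (k m : ℕ) (b : Bool) : List ℕ :=
  bif b then [colorCode m, natCode (k + 1), varCode (k + 1) k]
  else [natCode 0, colorCode m, natCode (k + 1), varCode (k + 1) k, natCode (k + 3)]

/-- The codes of the symbols in the antecedents `literals k w`. -/
def literalsCodes (k : ℕ) (w : List Bool) : List ℕ :=
  (List.range w.length).flatMap fun m => natCode 0 :: literalCodes k m (w.getD m false)

/-- The codes of the symbols in the antecedents `distinct k`. -/
def distinctCodes (k : ℕ) : List ℕ :=
  (List.range k).flatMap fun j =>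
    [natCode 0, natCode 0, varCode (k + 1) k, varCode (k + 1) j, natCode (k + 3)]

open Classical in
/-- The codes of the symbols in `patternSentence k w`. -/
noncomputable def patternCodes (k : ℕ) (w : List Bool) : List ℕ :=
  (List.range k).map (fun _ => natCode 1) ++
    if Consistent w then
      [natCode 0, natCode 1] ++ distinctCodes k ++ literalsCodes k w ++
        [natCode (k + 3), natCode (k + 2)]
    else [natCode 1] ++ literalsCodes k w ++ [natCode (k + 3)]

section ListEncode

variable {α : Type}

theorem listEncode_foldr_imp {n : ℕ} (l : List (lang.BoundedFormula α n))
    (f : lang.BoundedFormula α n) :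
    (l.foldr BoundedFormula.imp f).listEncode =
      (l.flatMap fun φ => .inr (.inr 0) :: φ.listEncode) ++ f.listEncode := by
  induction l with
  | nil => rfl
  | cons φ l ih => simp [BoundedFormula.listEncode, ih]

theorem listEncode_alls {n : ℕ} (φ : lang.BoundedFormula α n) :
    φ.alls.listEncode = (List.range n).map (fun _ => .inr (.inr 1)) ++ φ.listEncode := by
  induction n with
  | zero => rfl
  | succ n ih => simp [BoundedFormula.alls, ih, BoundedFormula.listEncode, List.range_succ]

end ListEncode

theorem encode_natSymbol (n : ℕ) :
    Encodable.encode (.inr (.inr n) :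
      (Σ k, lang.Term (Empty ⊕ Fin k)) ⊕ ((Σ n, lang.Relations n) ⊕ ℕ)) = natCode n := rfl

theorem map_encode_literal (k m : ℕ) (b : Bool) :
    (literal k m b).listEncode.map Encodable.encode = literalCodes k m b := by
  cases b <;> rfl

theorem map_encode_literals (k : ℕ) (w : List Bool) :
    ((literals k w).flatMap fun φ => .inr (.inr 0) :: φ.listEncode).map Encodable.encode =
      literalsCodes k w := by
  simp only [literals, literalsCodes, List.flatMap_map, List.map_flatMap, List.map_cons,
    map_encode_literal, encode_natSymbol]

theorem map_encode_distinct (k : ℕ) :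
    ((distinct k).flatMap fun φ => .inr (.inr 0) :: φ.listEncode).map Encodable.encode =
      distinctCodes k := by
  rw [distinctCodes, ← List.map_coe_finRange_eq_range]
  simp only [distinct, List.flatMap_map, List.map_flatMap]
  exact List.flatMap_congr fun j _ => rfl

theorem map_encode_patternSentence (k : ℕ) (w : List Bool) :
    (patternSentence k w).listEncode.map Encodable.encode = patternCodes k w := by
  by_cases hw : Consistent w
  · simp only [patternSentence, patternCodes, if_pos hw, listEncode_alls, BoundedFormula.listEncode,
      listEncode_foldr_imp, List.flatMap_append, List.map_append, List.map_cons, List.map_nil,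
      List.map_map, map_encode_literals, map_encode_distinct, encode_natSymbol,
      Function.comp_def]
    simp
  · simp only [patternSentence, patternCodes, if_neg hw, listEncode_alls, BoundedFormula.listEncode,
      listEncode_foldr_imp, List.map_append, List.map_cons, List.map_nil,
      List.map_map, map_encode_literals, encode_natSymbol, Function.comp_def]
    simp

theorem sentenceCode_patternSentence (k : ℕ) (w : List Bool) :
    sentenceCode (patternSentence k w) = Encodable.encode (patternCodes k w) := by
  rw [sentenceCode, encode_list_eq_encode_map, map_encode_patternSentence]

theorem le_encode_patternCodes (k : ℕ) (w : List Bool) : k ≤ Encodable.encode (patternCodes k w) :=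
  le_trans (by simp [patternCodes]) (Encodable.length_le_encode _)

theorem primrec_natCode : Primrec natCode :=
  Primrec.succ.comp (Primrec.nat_double.comp (Primrec.succ.comp Primrec.nat_double))

theorem primrec_colorCode : Primrec colorCode :=
  Primrec.succ.comp (Primrec.nat_double.comp (Primrec.nat_double.comp
    (Primrec₂.natPair.comp (Primrec.const 1) Primrec.id)))

theorem primrec_varCode : Primrec₂ varCode :=
  Primrec.nat_double.comp (Primrec₂.natPair.comp Primrec.fst (Primrec.succ.comp
    (Primrec₂.natPair.comp (Primrec.nat_double.comp (Primrec.succ.comp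
      (Primrec.nat_double.comp Primrec.snd))) (Primrec.const 0))))

theorem primrec_halted : Primrec₂ halted :=
  Primrec.option_isSome.comp (Nat.Partrec.Code.primrec_evaln.comp
    ((Primrec.fst.pair ((Primrec.ofNat _).comp Primrec.snd)).pair Primrec.snd))

theorem primrec_val : Primrec fun p : (ℕ × Bool) × ℕ => val p.1.1 p.1.2 p.2 :=
  Primrec.cond (Primrec.nat_bodd.comp Primrec.snd)
    (Primrec.and.comp (Primrec.snd.comp Primrec.fst)
      (primrec_halted.comp (Primrec.nat_div2.comp Primrec.snd) (Primrec.fst.comp Primrec.fst)))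
    (Primrec.eq.decide.comp (Primrec.nat_div2.comp Primrec.snd) (Primrec.fst.comp Primrec.fst))

theorem primrecPred_consistent : PrimrecPred Consistent := by
  have hmap (b : Bool) : PrimrecRel fun (i : ℕ) (w : List Bool) =>
      w = (List.range w.length).map (val i b) :=
    Primrec.eq.comp Primrec.snd (Primrec.list_map
      (Primrec.list_range.comp (Primrec.list_length.comp Primrec.snd))
      (primrec_val.comp (((Primrec.fst.comp Primrec.fst).pair (Primrec.const b)).pair Primrec.snd)))
  have hor : PrimrecRel fun (i : ℕ) (w : List Bool) =>
      w = (List.range w.length).map (val i true) ∨ w = (List.range w.length).map (val i false) :=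
    PrimrecPred.or (hmap true) (hmap false)
  exact (hor.exists_mem_list.comp (Primrec.list_range.comp
    (Primrec.succ.comp Primrec.list_length)) Primrec.id).of_eq fun w => by simp [Consistent]

theorem primrec_literalsCodes : Primrec₂ literalsCodes := by
  have hk : Primrec fun p : (ℕ × List Bool) × ℕ => p.1.1 := Primrec.fst.comp Primrec.fst
  have hk1 := Primrec.succ.comp hk
  have hk3 := Primrec.succ.comp (Primrec.succ.comp hk1)
  have hcolor := primrec_colorCode.comp (Primrec.snd (α := ℕ × List Bool) (β := ℕ))
  have htail (l : ((ℕ × List Bool) × ℕ) → List ℕ) (hl : Primrec l) :=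
    Primrec.list_cons.comp hcolor (Primrec.list_cons.comp (primrec_natCode.comp hk1)
      (Primrec.list_cons.comp (primrec_varCode.comp hk1 hk) hl))
  refine Primrec.list_flatMap (Primrec.list_range.comp (Primrec.list_length.comp Primrec.snd))
    (Primrec.list_cons.comp (Primrec.const (natCode 0)) (Primrec.cond ?_ (htail _ (Primrec.const []))
      (Primrec.list_cons.comp (Primrec.const (natCode 0)) (htail _
        (Primrec.list_cons.comp (primrec_natCode.comp hk3) (Primrec.const []))))))
  exact (Primrec.list_getD false).comp (Primrec.snd.comp Primrec.fst) Primrec.snd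

theorem primrec_distinctCodes : Primrec distinctCodes := by
  have hk : Primrec fun p : ℕ × ℕ => p.1 := Primrec.fst
  have hk1 := Primrec.succ.comp hk
  have hk3 := Primrec.succ.comp (Primrec.succ.comp hk1)
  exact Primrec.list_flatMap Primrec.list_range
    (Primrec.list_cons.comp (Primrec.const (natCode 0))
      (Primrec.list_cons.comp (Primrec.const (natCode 0))
        (Primrec.list_cons.comp (primrec_varCode.comp hk1 hk)
          (Primrec.list_cons.comp (primrec_varCode.comp hk1 Primrec.snd)
            (Primrec.list_cons.comp (primrec_natCode.comp hk3) (Primrec.const []))))))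

theorem primrec_patternCodes : Primrec₂ patternCodes := by
  classical
  have hk : Primrec fun p : ℕ × List Bool => p.1 := Primrec.fst
  have hk2 := Primrec.succ.comp (Primrec.succ.comp hk)
  have hk3 := Primrec.succ.comp hk2
  have hlast := Primrec.list_cons.comp (primrec_natCode.comp hk2) (Primrec.const [])
  have hend (l : ℕ × List Bool → List ℕ) (hl : Primrec l) :=
    Primrec.list_cons.comp (primrec_natCode.comp hk3) hl
  refine Primrec.list_append.comp
    (Primrec.list_map (Primrec.list_range.comp hk) (Primrec₂.const (natCode 1)))
    (Primrec.ite (primrecPred_consistent.comp Primrec.snd) ?_ ?_)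
  · exact Primrec.list_append.comp (Primrec.list_append.comp (Primrec.list_append.comp
      (Primrec.const _) (primrec_distinctCodes.comp hk)) primrec_literalsCodes) (hend _ hlast)
  · exact Primrec.list_append.comp (Primrec.list_append.comp (Primrec.const _)
      primrec_literalsCodes) (hend _ (Primrec.const []))

theorem primrec_patternOf : Primrec patternOf :=
  Primrec.option_getD.comp (Primrec.decode.comp (Primrec.fst.comp Primrec.unpair))
    (Primrec.const [])

theorem sentenceCode_injective : Function.Injective (sentenceCode (L := lang)) := by
  intro σ τ h
  have := BoundedFormula.listEncode_sigma_injective (L := lang) (α := Empty)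
    (a₁ := ⟨0, σ⟩) (a₂ := ⟨0, τ⟩) (Encodable.encode_injective h)
  simpa using this

theorem isDecidableTheory_theory : IsDecidableTheory theory := by
  have hcode : Primrec fun k => Encodable.encode (patternCodes k (patternOf k)) :=
    Primrec.encode.comp (primrec_patternCodes.comp Primrec.id primrec_patternOf)
  have hrel : PrimrecRel fun k c : ℕ => Encodable.encode (patternCodes k (patternOf k)) = c :=
    Primrec.eq.comp (hcode.comp Primrec.fst) Primrec.snd
  have hpred : PrimrecPred fun c : ℕ =>
      ∃ k < c + 1, Encodable.encode (patternCodes k (patternOf k)) = c :=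
    hrel.exists_lt.comp Primrec.succ Primrec.id
  obtain ⟨_, hdec⟩ := hpred
  refine ⟨_, hdec.to_comp, fun σ => ?_⟩
  rw [decide_eq_true_iff]
  constructor
  · rintro ⟨k, -, hk⟩
    exact ⟨k, sentenceCode_injective ((sentenceCode_patternSentence _ _).trans hk)⟩
  · rintro ⟨k, rfl⟩
    have hk := sentenceCode_patternSentence k (patternOf k)
    exact ⟨k, Nat.lt_succ_of_le (hk ▸ le_encode_patternCodes _ _), hk.symm⟩

theorem computable_fmlCode_colorFormula :
    Computable fun i => fmlCode (colorFormula (2 * i) (0 : Fin 1)) := by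
  have hcode (i : ℕ) : fmlCode (colorFormula (2 * i) (0 : Fin 1)) =
      Nat.pair 1 (Encodable.encode [colorCode (2 * i), natCode 0,
        2 * Nat.pair 0 (Nat.succ (Nat.pair 0 0))]) := by
    rw [fmlCode, encode_list_eq_encode_map]
    rfl
  simp only [hcode]
  exact (Primrec₂.natPair.comp (Primrec.const 1) (Primrec.encode.comp (Primrec.list_cons.comp
    (primrec_colorCode.comp Primrec.nat_double) (Primrec.const _)))).to_comp

theorem fmlCode_inj {m n : ℕ} {φ : lang.Formula (Fin m)} {ψ : lang.Formula (Fin n)}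
    (h : fmlCode φ = fmlCode ψ) :
    (⟨m, φ⟩ : Σ k, lang.Formula (Fin k)) = ⟨n, ψ⟩ := by
  obtain ⟨rfl, h⟩ := Nat.pair_eq_pair.1 h
  have := BoundedFormula.listEncode_sigma_injective (L := lang) (α := Fin m)
    (a₁ := ⟨0, φ⟩) (a₂ := ⟨0, ψ⟩) (Encodable.encode_injective h)
  simpa using this

end ColorTheory

/-- There are a language `L` with encodable symbol sets and a complete, decidable `L`-theory
`T` with an atomic model, together with a computable function producing codes of formulas in
one free variable, such that the `i`-th formula produced is a complete formula for `T`
exactly when the `i`-th partial computable function diverges on input `i`.  In particular,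
the complement of the halting set many-one reduces to the set of codes of complete formulas
for `T`. -/
theorem exists_theory_complete_formulas_Pi01_complete :
    ∃ (L : FirstOrder.Language.{0, 0}) (eF : ∀ k, Encodable (L.Functions k))
      (eR : ∀ k, Encodable (L.Relations k)) (T : L.Theory),
      T.IsComplete ∧
      (@IsDecidableTheory L eF eR T) ∧
      (∃ (A : Type) (SA : L.Structure A), Nonempty A ∧
        (@FirstOrder.Language.Theory.Model L A SA T) ∧
        (letI := SA;
          ∀ (n : ℕ) (a : Fin n → A), ∃ φ : L.Formula (Fin n),
            IsCompleteFormula T φ ∧ φ.Realize a)) ∧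
      (∃ F : ℕ → L.Formula (Fin 1),
        Computable (fun i => @fmlCode L eF eR 1 (F i)) ∧
        ∀ i : ℕ, (IsCompleteFormula T (F i) ↔
          ¬((Nat.Partrec.Code.eval (Denumerable.ofNat Nat.Partrec.Code i)) i).Dom)) ∧
      (∃ g : ℕ → ℕ, Computable g ∧ ∀ i : ℕ,
        (¬((Nat.Partrec.Code.eval (Denumerable.ofNat Nat.Partrec.Code i)) i).Dom ↔
          ∃ (n : ℕ) (φ : L.Formula (Fin n)),
            g i = @fmlCode L eF eR n φ ∧ IsCompleteFormula T φ)) := by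
  refine ⟨ColorTheory.lang, inferInstance, inferInstance, ColorTheory.theory,
    ColorTheory.isComplete_theory, ColorTheory.isDecidableTheory_theory,
    ⟨ColorTheory.Std, inferInstance, inferInstance, inferInstance, fun _ a =>
      ColorTheory.exists_isCompleteFormula_realize a⟩,
    ⟨fun i => ColorTheory.colorFormula (2 * i) 0, ColorTheory.computable_fmlCode_colorFormula,
      ColorTheory.isCompleteFormula_colorFormula_iff⟩,
    _, ColorTheory.computable_fmlCode_colorFormula, fun i => ?_⟩
  rw [← ColorTheory.isCompleteFormula_colorFormula_iff]
  refine ⟨fun h => ⟨1, _, rfl, h⟩, ?_⟩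
  rintro ⟨n, φ, hcode, hφ⟩
  obtain ⟨rfl, h⟩ := Sigma.mk.inj_iff.1 (ColorTheory.fmlCode_inj hcode)
  exact eq_of_heq h ▸ hφ
end
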